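/- Let (X,‖·‖) be a Banach space and T : X → X a (b,θ)-enriched contraction, i.e. there exist b ∈ [0,∞) and θ ∈ [0,b+1) such that ‖b(x−y) + Tx − Ty‖ ≤ θ‖x−y‖ for all x,y ∈ X. Then: (1) T has a unique fixed point p; (2) there exists λ ∈ (0,1] such that the Krasnoselskij iteration xₙ₊₁ = (1−λ)xₙ + λTxₙ converges to p for every x₀ ∈ X; (3) with δ = θ/(b+1), the estimate ‖xₙ − p‖ ≤ δⁿ/(1−δ)·‖x₀ − x₁‖ holds for all n ≥ 0. -/

import Mathlib

/-- Averaging with parameter `lam` does not change the fixed points. -/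
theorem averaged_isFixedPt_iff {X : Type*} [AddCommGroup X] [Module ℝ X]
    (T : X → X) {lam : ℝ} (hlam : lam ≠ 0) (z : X) :
    Function.IsFixedPt (fun z => (1 - lam) • z + lam • T z) z ↔ T z = z := by
  have h : (1 - lam) • z + lam • T z - z = lam • (T z - z) := by module
  rw [Function.IsFixedPt, ← sub_eq_zero, h, smul_eq_zero, sub_eq_zero]
  exact or_iff_right hlam

/-- The average of an enriched contraction with parameter `1 / (b + 1)` is a contraction. -/
theorem contractingWith_averaged_of_enriched
    {X : Type*} [NormedAddCommGroup X] [NormedSpace ℝ X]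
    (T : X → X) (b θ : ℝ) (hb : 0 ≤ b) (hθ0 : 0 ≤ θ) (hθ : θ < b + 1)
    (hT : ∀ x y : X, ‖b • (x - y) + T x - T y‖ ≤ θ * ‖x - y‖) :
    ContractingWith (NNReal.mk (θ / (b + 1)) (by positivity))
      (fun z => (1 - (b + 1)⁻¹) • z + (b + 1)⁻¹ • T z) := by
  have hb1 : 0 < b + 1 := by linarith
  refine ⟨NNReal.coe_lt_coe.mp ((div_lt_one hb1).mpr hθ), LipschitzWith.of_dist_le_mul fun x y => ?_⟩
  have hcoef : 1 - (b + 1)⁻¹ = (b + 1)⁻¹ * b := by field_simp; ring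
  have h : (1 - (b + 1)⁻¹) • x + (b + 1)⁻¹ • T x - ((1 - (b + 1)⁻¹) • y + (b + 1)⁻¹ • T y) =
      (b + 1)⁻¹ • (b • (x - y) + T x - T y) := by
    rw [hcoef]; module
  rw [dist_eq_norm, dist_eq_norm, h, norm_smul, Real.norm_of_nonneg (inv_nonneg.mpr hb1.le)]
  calc (b + 1)⁻¹ * ‖b • (x - y) + T x - T y‖ ≤ (b + 1)⁻¹ * (θ * ‖x - y‖) := by
        gcongr; exact hT x y
    _ = θ / (b + 1) * ‖x - y‖ := by ring

/-- **Theorem (Berinde–Păcurar, 2020).** Let `X` be a Banach space and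
`T : X → X` a `(b,θ)`-enriched contraction: `b ≥ 0`, `0 ≤ θ < b+1` and
`‖b(x−y) + Tx − Ty‖ ≤ θ‖x−y‖` for all `x,y`. Then `T` has a unique fixed point
`p`; there exists `λ ∈ (0,1]` such that the Krasnoselskij iteration
`xₙ₊₁ = (1−λ)xₙ + λTxₙ` converges to `p` for every `x₀`, with the a priori
estimate `‖xₙ − p‖ ≤ δⁿ/(1−δ)·‖x₀ − x₁‖` where `δ = θ/(b+1)`. -/
theorem enriched_contraction_fixed_point
    {X : Type*} [NormedAddCommGroup X] [NormedSpace ℝ X] [CompleteSpace X]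
    (T : X → X) (b θ : ℝ) (hb : 0 ≤ b) (hθ0 : 0 ≤ θ) (hθ : θ < b + 1)
    (hT : ∀ x y : X, ‖b • (x - y) + T x - T y‖ ≤ θ * ‖x - y‖) :
    ∃ p : X, T p = p ∧ (∀ q : X, T q = q → q = p) ∧
      ∃ lam ∈ Set.Ioc (0 : ℝ) 1,
        ∀ x₀ : X,
          Filter.Tendsto (fun n => (fun z => (1 - lam) • z + lam • T z)^[n] x₀)
            Filter.atTop (nhds p) ∧
          ∀ n : ℕ, ‖(fun z => (1 - lam) • z + lam • T z)^[n] x₀ - p‖ ≤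
            (θ / (b + 1)) ^ n / (1 - θ / (b + 1)) *
              ‖x₀ - ((1 - lam) • x₀ + lam • T x₀)‖ := by
  have hb1 : 0 < b + 1 := by linarith
  have hlam : (b + 1)⁻¹ ≠ 0 := inv_ne_zero hb1.ne'
  have hf := contractingWith_averaged_of_enriched T b θ hb hθ0 hθ hT
  have : Nonempty X := ⟨0⟩
  refine ⟨ContractingWith.fixedPoint _ hf, (averaged_isFixedPt_iff T hlam _).mp hf.fixedPoint_isFixedPt,
    fun q hq => hf.fixedPoint_unique ((averaged_isFixedPt_iff T hlam q).mpr hq),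
    (b + 1)⁻¹, ⟨inv_pos.mpr hb1, inv_le_one_of_one_le₀ (by linarith)⟩,
    fun x₀ => ⟨hf.tendsto_iterate_fixedPoint x₀, fun n => ?_⟩⟩
  have h := hf.apriori_dist_iterate_fixedPoint_le x₀ n
  rw [dist_eq_norm, dist_eq_norm] at h
  refine h.trans_eq ?_
  rw [NNReal.coe_mk]
  ring
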